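/- arXiv:1511.08224 — 14 statements merged into one kernel-verified Lean document; each statement's English description precedes it below -/
import Mathlib

section
/- For A ⊆ ℝⁿ, the following are equivalent: (i) A is generic; (ii) whenever x and y are distinct elements of A with xᵢ = yᵢ for some coordinate i ∈ Fin n, there exists z ∈ A with z << x ⊔ y (where x ⊔ y is the coordinatewise maximum). -/
/-- `B` is `A`-neighborly: `B` is nonempty, bounded above, and no point of `A`
is strictly below (in every coordinate) the coordinatewise supremum of `B`. -/
def IsNbly {n : ℕ} (A B : Set (Fin n → ℝ)) : Prop :=
  B.Nonempty ∧ BddAbove B ∧ ∀ a ∈ A, ¬ ∀ i, a i < sSup B i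

/-- `A` is generic: for every `A`-neighborly subset `B ⊆ A` and each coordinate `i`,
there is at most one element of `A` in the `i`-th face of the bonnet over `B`. -/
def IsGeneric {n : ℕ} (A : Set (Fin n → ℝ)) : Prop :=
  ∀ B ⊆ A, IsNbly A B → ∀ i : Fin n,
    Set.Subsingleton {a ∈ A | a ≤ sSup B ∧ a i = sSup B i}

theorem Pi.sSup_pair_real {ι : Type*} (x y : ι → ℝ) : sSup {x, y} = x ⊔ y := by
  funext i
  rw [sSup_apply_eq_sSup_image, Set.image_pair, csSup_pair, Pi.sup_apply]

theorem stmt2 {n : ℕ} (A : Set (Fin n → ℝ)) :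
    IsGeneric A ↔
      ∀ x ∈ A, ∀ y ∈ A, x ≠ y → (∃ i, x i = y i) →
        ∃ z ∈ A, ∀ i, z i < (x ⊔ y) i := by
  constructor
  · intro hA x hx y hy hxy ⟨i, hi⟩
    by_contra hz
    have hB : IsNbly A {x, y} := by
      refine ⟨Set.insert_nonempty x {y}, ⟨x ⊔ y, ?_⟩, fun a ha h => hz ⟨a, ha, ?_⟩⟩
      · rintro b (rfl | rfl)
        exacts [le_sup_left, le_sup_right]
      · rwa [Pi.sSup_pair_real] at h
    refine hxy (hA {x, y} (Set.pair_subset hx hy) hB i ⟨hx, ?_, ?_⟩ ⟨hy, ?_, ?_⟩) <;>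
      rw [Pi.sSup_pair_real]
    exacts [le_sup_left, by simp [hi], le_sup_right, by simp [hi]]
  · intro h B _ hB i a ⟨ha, haB, hai⟩ b ⟨hb, hbB, hbi⟩
    by_contra hab
    obtain ⟨z, hz, hzab⟩ := h a ha b hb hab ⟨i, hai.trans hbi.symm⟩
    exact hB.2.2 z hz fun j => (hzab j).trans_le (sup_le haB hbB j)
end

section
/- Suppose A ⊆ ℝⁿ is generic and B ⊆ A is a finite nonempty A-neighborly set. Then the cardinality of B is at most n. -/
/-- A member of a bounded-above set of real vectors lies below the coordinatewise supremum. -/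
theorem le_sSup_apply_of_mem {ι : Type*} {B : Set (ι → ℝ)} (h : BddAbove B) {b : ι → ℝ}
    (hb : b ∈ B) (i : ι) : b i ≤ sSup B i := by
  obtain ⟨u, hu⟩ := h
  rw [sSup_apply]
  refine le_ciSup (f := fun f : B => (f : ι → ℝ) i) ⟨u i, ?_⟩ ⟨b, hb⟩
  rintro _ ⟨f, rfl⟩
  exact hu f.2 i

theorem stmt4 {n : ℕ} (A B : Set (Fin n → ℝ)) (hA : IsGeneric A) (hBA : B ⊆ A)
    (hfin : B.Finite) (hne : B.Nonempty) (hB : IsNbly A B) :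
    B.ncard ≤ n := by
  have hle : ∀ b ∈ B, b ≤ sSup B := fun b hb i => le_sSup_apply_of_mem hB.2.1 hb i
  have hex : ∀ b : B, ∃ i, (b : Fin n → ℝ) i = sSup B i := by
    intro b
    by_contra! hne'
    exact hB.2.2 b (hBA b.2) fun i => lt_of_le_of_ne (hle b b.2 i) (hne' i)
  choose f hf using hex
  have hinj : Function.Injective f := by
    intro b c hbc
    refine Subtype.ext (hA B hBA hB (f b) ⟨hBA b.2, hle b b.2, hf b⟩ ⟨hBA c.2, hle c c.2, ?_⟩)
    rw [hbc]
    exact hf c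
  rw [← Nat.card_coe_set_eq]
  simpa using Nat.card_le_card_of_injective f hinj
end

section
/- Suppose A ⊆ ℝⁿ is generic and B ⊆ A is a finite nonempty A-neighborly set. Then the only elements of A in the bonnet over B are the elements of B itself: if a ∈ A and a ≤ ⋁B, then a ∈ B. -/
theorem stmt5 {n : ℕ} (A B : Set (Fin n → ℝ)) (hA : IsGeneric A) (hBA : B ⊆ A)
    (hfin : B.Finite) (hne : B.Nonempty) (hB : IsNbly A B) :
    ∀ a ∈ A, a ≤ sSup B → a ∈ B := by
  intro a ha haB
  obtain ⟨i, hi⟩ := not_forall.mp (hB.2.2 a ha)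
  have : Finite B := hfin
  have : Nonempty B := hne.to_subtype
  have hsup (j : Fin n) : sSup B j = ⨆ f : B, f.1 j := sSup_apply
  obtain ⟨⟨b, hb⟩, hbi⟩ := exists_eq_ciSup_of_finite (f := fun f : B => f.1 i)
  have hbB : b ≤ sSup B := fun j => by
    rw [hsup]
    exact le_ciSup (f := fun f : B => f.1 j) (Set.finite_range _).bddAbove ⟨b, hb⟩
  have hab : a = b := hA B hBA hB i ⟨ha, haB, le_antisymm (haB i) (not_lt.mp hi)⟩
    ⟨hBA hb, hbB, hbi.trans (hsup i).symm⟩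
  exact hab ▸ hb
end

section
/- Suppose A ⊆ ℝⁿ is generic and B ⊆ A is a finite nonempty A-neighborly set. For each b ∈ B let J_b := { i ∈ Fin n : bᵢ = (⋁B)ᵢ }. Then the sets J_b (b ∈ B) are nonempty, pairwise disjoint, and their union is all of Fin n; in particular, the sum of the codimensions of the minimal faces of the bonnet over B containing the elements of B is exactly n. -/
/-- Each element of a set bounded above lies coordinatewise below its supremum. -/
theorem le_pi_sSup {n : ℕ} {B : Set (Fin n → ℝ)} (hB : BddAbove B) {b : Fin n → ℝ}
    (hb : b ∈ B) : b ≤ sSup B := by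
  intro i
  obtain ⟨u, hu⟩ := hB
  rw [sSup_apply]
  exact le_ciSup (f := fun f : B => (f : Fin n → ℝ) i)
    ⟨u i, by rintro _ ⟨f, rfl⟩; exact hu f.2 i⟩ ⟨b, hb⟩

/-- A finite nonempty set attains its supremum in every coordinate. -/
theorem exists_mem_apply_eq_pi_sSup {n : ℕ} {B : Set (Fin n → ℝ)} (hfin : B.Finite)
    (hne : B.Nonempty) (i : Fin n) : ∃ b ∈ B, b i = sSup B i := by
  have := hfin.to_subtype
  have := hne.to_subtype
  obtain ⟨b, hb⟩ := exists_eq_ciSup_of_finite (f := fun f : B => (f : Fin n → ℝ) i)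
  exact ⟨b, b.2, by rw [sSup_apply]; exact hb⟩

theorem stmt6 {n : ℕ} (A B : Set (Fin n → ℝ)) (hA : IsGeneric A) (hBA : B ⊆ A)
    (hfin : B.Finite) (hne : B.Nonempty) (hB : IsNbly A B) :
    (∀ b ∈ B, {i : Fin n | b i = sSup B i}.Nonempty) ∧
    (∀ b ∈ B, ∀ b' ∈ B, b ≠ b' →
      Disjoint {i : Fin n | b i = sSup B i} {i : Fin n | b' i = sSup B i}) ∧
    (⋃ b ∈ B, {i : Fin n | b i = sSup B i}) = Set.univ := by
  have hle : ∀ b ∈ B, b ≤ sSup B := fun b hb => le_pi_sSup hB.2.1 hb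
  refine ⟨fun b hb => ?_, fun b hb b' hb' hbb' => ?_, ?_⟩
  · by_contra h
    exact hB.2.2 b (hBA hb) fun i => lt_of_le_of_ne (hle b hb i) fun hi => h ⟨i, hi⟩
  · rw [Set.disjoint_left]
    intro i hi hi'
    exact hbb' (hA B hBA hB i ⟨hBA hb, hle b hb, hi⟩ ⟨hBA hb', hle b' hb', hi'⟩)
  · refine Set.eq_univ_of_forall fun i => ?_
    obtain ⟨b, hb, hi⟩ := exists_mem_apply_eq_pi_sSup hfin hne i
    exact Set.mem_biUnion hb hi
end

section
/- Suppose A ⊆ ℝⁿ is generic and B, B' ⊆ A are finite nonempty A-neighborly sets with ⋁B = ⋁B'. Then B = B'. -/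
theorem le_sSup_pi {ι : Type*} {B : Set (ι → ℝ)} (hB : BddAbove B)
    {b : ι → ℝ} (hb : b ∈ B) : b ≤ sSup B := by
  intro i
  rw [sSup_apply]
  obtain ⟨u, hu⟩ := hB
  exact le_ciSup (f := fun f : B => f.1 i) ⟨u i, by rintro _ ⟨f, rfl⟩; exact hu f.2 i⟩ ⟨b, hb⟩

theorem exists_mem_apply_eq_sSup {ι : Type*} {B : Set (ι → ℝ)} (hfin : B.Finite)
    (hne : B.Nonempty) (i : ι) : ∃ b ∈ B, b i = sSup B i := by
  have := hfin.to_subtype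
  have := hne.to_subtype
  obtain ⟨b, hb⟩ := exists_eq_ciSup_of_finite (f := fun f : B => f.1 i)
  exact ⟨b.1, b.2, by rw [sSup_apply]; exact hb⟩

theorem IsGeneric.subset_of_sSup_eq {n : ℕ} {A B B' : Set (Fin n → ℝ)} (hA : IsGeneric A)
    (hBA : B ⊆ A) (hB : IsNbly A B) (hBA' : B' ⊆ A) (hfin' : B'.Finite) (hB' : IsNbly A B')
    (hsup : sSup B = sSup B') : B ⊆ B' := by
  intro b hb
  have hle : b ≤ sSup B := le_sSup_pi hB.2.1 hb
  obtain ⟨i, hi⟩ := not_forall.1 (hB.2.2 b (hBA hb))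
  obtain ⟨b', hb', hi'⟩ := exists_mem_apply_eq_sSup hfin' hB'.1 i
  have hle' : b' ≤ sSup B := hsup ▸ le_sSup_pi hB'.2.1 hb'
  have heq : b = b' := hA B hBA hB i ⟨hBA hb, hle, le_antisymm (hle i) (not_lt.1 hi)⟩
    ⟨hBA' hb', hle', by rw [hi', hsup]⟩
  exact heq ▸ hb'

theorem stmt7 {n : ℕ} (A B B' : Set (Fin n → ℝ)) (hA : IsGeneric A)
    (hBA : B ⊆ A) (hfin : B.Finite) (hne : B.Nonempty) (hB : IsNbly A B)
    (hBA' : B' ⊆ A) (hfin' : B'.Finite) (hne' : B'.Nonempty) (hB' : IsNbly A B')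
    (hsup : sSup B = sSup B') :
    B = B' := by
  exact (hA.subset_of_sSup_eq hBA hB hBA' hfin' hB' hsup).antisymm
    (hA.subset_of_sSup_eq hBA' hB' hBA hfin hB hsup.symm)
end

section
/- Suppose A ⊆ ℝⁿ is generic and x, y ∈ A are distinct with {x, y} A-neighborly. Then x is a weak A-neighbor of y: there is no z ∈ A with z ≠ x, z ≠ y, and min(xᵢ, yᵢ) ≤ zᵢ ≤ max(xᵢ, yᵢ) for all i ∈ Fin n. -/
theorem sSup_pair_apply_eq_max {ι : Type*} (x y : ι → ℝ) (i : ι) :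
    sSup {x, y} i = max (x i) (y i) := by
  rw [sSup_apply_eq_sSup_image, Set.image_pair]
  exact csSup_pair _ _

theorem stmt8 {n : ℕ} (A : Set (Fin n → ℝ)) (hA : IsGeneric A) (x y : Fin n → ℝ)
    (hx : x ∈ A) (hy : y ∈ A) (hxy : x ≠ y) (hnb : IsNbly A {x, y}) :
    ¬ ∃ z ∈ A, z ≠ x ∧ z ≠ y ∧
      ∀ i, min (x i) (y i) ≤ z i ∧ z i ≤ max (x i) (y i) := by
  rintro ⟨z, hz, hzx, hzy, hbox⟩
  obtain ⟨i, hi⟩ := not_forall.mp (hnb.2.2 z hz)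
  rw [sSup_pair_apply_eq_max, not_lt] at hi
  have hface := hA {x, y} (Set.pair_subset hx hy) hnb i
  have hzi : z i = sSup {x, y} i :=
    ((hbox i).2.antisymm hi).trans (sSup_pair_apply_eq_max x y i).symm
  have hz_le : z ≤ sSup {x, y} := fun j ↦ by
    rw [sSup_pair_apply_eq_max]; exact (hbox j).2
  have hx_le : x ≤ sSup {x, y} := fun j ↦ by
    rw [sSup_pair_apply_eq_max]; exact le_max_left _ _
  have hy_le : y ≤ sSup {x, y} := fun j ↦ by
    rw [sSup_pair_apply_eq_max]; exact le_max_right _ _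
  rcases max_choice (x i) (y i) with h | h
  · exact hzx (hface ⟨hz, hz_le, hzi⟩
      ⟨hx, hx_le, ((sSup_pair_apply_eq_max x y i).trans h).symm⟩)
  · exact hzy (hface ⟨hz, hz_le, hzi⟩
      ⟨hy, hy_le, ((sSup_pair_apply_eq_max x y i).trans h).symm⟩)
end

section
/- Let A ⊆ ℤⁿ and β ∈ ℤⁿ. Then the set of weak A-neighbors of β is finite. -/
/-- `x` is a weak `A`-neighbor of `y`: `x ∈ A`, `x ≠ y`, and no `z ∈ A` other
than `x` and `y` lies in the rectangle from `x` to `y`. -/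
def IsWeakNbr {n : ℕ} (A : Set (Fin n → ℤ)) (x y : Fin n → ℤ) : Prop :=
  x ∈ A ∧ x ≠ y ∧ ¬ ∃ z ∈ A, z ≠ x ∧ z ≠ y ∧
    ∀ i, min (x i) (y i) ≤ z i ∧ z i ≤ max (x i) (y i)

/-- The positive and negative parts of the coordinates of `x - β`. -/
def posNegParts {n : ℕ} (β x : Fin n → ℤ) : Fin n → ℕ × ℕ :=
  fun i => ((x i - β i).toNat, (β i - x i).toNat)

theorem posNegParts_le_iff {n : ℕ} (β z x : Fin n → ℤ) :
    posNegParts β z ≤ posNegParts β x ↔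
      ∀ i, min (x i) (β i) ≤ z i ∧ z i ≤ max (x i) (β i) := by
  refine forall_congr' fun i => ?_
  simp only [posNegParts, Prod.mk_le_mk]
  omega

theorem posNegParts_injective {n : ℕ} (β : Fin n → ℤ) :
    Function.Injective (posNegParts β) := by
  intro x y h
  ext i
  have hi := congrFun h i
  simp only [posNegParts, Prod.mk.injEq] at hi
  omega

theorem isAntichain_posNegParts_image {n : ℕ} (A : Set (Fin n → ℤ)) (β : Fin n → ℤ) :
    IsAntichain (· ≤ ·) (posNegParts β '' {x | IsWeakNbr A x β}) := by
  rintro _ ⟨z, hz, rfl⟩ _ ⟨x, hx, rfl⟩ hne hle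
  exact hx.2.2 ⟨z, hz.1, fun h => hne (congrArg _ h), hz.2.1, (posNegParts_le_iff β z x).1 hle⟩

theorem stmt9 {n : ℕ} (A : Set (Fin n → ℤ)) (β : Fin n → ℤ) :
    {x | IsWeakNbr A x β}.Finite :=
  Set.Finite.of_finite_image
    (WellQuasiOrderedLE.finite_of_isAntichain (isAntichain_posNegParts_image A β))
    (posNegParts_injective β).injOn
end

section
/- Let A ⊆ ℤⁿ be generic and β ∈ A. Then the set of A-neighbors of β in A, namely { a ∈ A : there is no z ∈ A with z << a ⊔ β }, is finite. -/
/-- `B` is `A`-neighborly (in `ℤⁿ`): `B` is nonempty, bounded above, and no point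
of `A` is strictly below (in every coordinate) the coordinatewise supremum of `B`. -/
def IsNblyZ {n : ℕ} (A B : Set (Fin n → ℤ)) : Prop :=
  B.Nonempty ∧ BddAbove B ∧ ∀ a ∈ A, ¬ ∀ i, a i < sSup B i

/-- `A ⊆ ℤⁿ` is generic: for every `A`-neighborly subset `B ⊆ A` and each coordinate `i`,
there is at most one element of `A` in the `i`-th face of the bonnet over `B`. -/
def IsGenericZ {n : ℕ} (A : Set (Fin n → ℤ)) : Prop :=
  ∀ B ⊆ A, IsNblyZ A B → ∀ i : Fin n,
    Set.Subsingleton {a ∈ A | a ≤ sSup B ∧ a i = sSup B i}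

theorem sSup_pair_int {n : ℕ} (a b : Fin n → ℤ) : sSup {a, b} = a ⊔ b := by
  funext i
  rw [sSup_apply, ← sSup_range]
  have : Set.range (fun f : ({a, b} : Set (Fin n → ℤ)) => (f : Fin n → ℤ) i) = {a i, b i} := by
    ext x
    simp
  rw [this, csSup_pair]
  rfl

theorem exists_ne_le_sup_of_infinite {n : ℕ} (β : Fin n → ℤ) {S : Set (Fin n → ℤ)}
    (hS : S.Infinite) : ∃ a ∈ S, ∃ b ∈ S, a ≠ b ∧ a ≤ b ⊔ β := by
  let s := hS.natEmbedding
  obtain ⟨k, l, hkl, hle⟩ := wellQuasiOrdered_le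
    (fun k => fun i => ((s k : Fin n → ℤ) i - β i).toNat)
  refine ⟨s k, (s k).2, s l, (s l).2, fun h => hkl.ne (s.injective (Subtype.ext h)), fun i => ?_⟩
  have : ((s k : Fin n → ℤ) i - β i).toNat ≤ ((s l : Fin n → ℤ) i - β i).toNat := hle i
  simp only [Pi.sup_apply, le_sup_iff]
  omega

theorem stmt10 {n : ℕ} (A : Set (Fin n → ℤ)) (hA : IsGenericZ A)
    (β : Fin n → ℤ) (hβ : β ∈ A) :
    {a ∈ A | ¬ ∃ z ∈ A, ∀ i, z i < (a ⊔ β) i}.Finite := by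
  by_contra hinf
  have hinf' := Set.Infinite.sdiff hinf (Set.finite_singleton β)
  obtain ⟨a, ⟨⟨haA, -⟩, haβ⟩, b, ⟨⟨hbA, hb⟩, -⟩, hab, hle⟩ :=
    exists_ne_le_sup_of_infinite β hinf'
  have hsup := sSup_pair_int b β
  have hsub : ({b, β} : Set (Fin n → ℤ)) ⊆ A := by
    rintro x (rfl | rfl) <;> assumption
  have hnbly : IsNblyZ A {b, β} := by
    refine ⟨Set.insert_nonempty _ _, (Set.toFinite _).bddAbove, fun z hz hlt => ?_⟩
    rw [hsup] at hlt
    exact hb ⟨z, hz, hlt⟩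
  obtain ⟨i, hi⟩ : ∃ i, (b ⊔ β) i ≤ a i := by
    by_contra! h
    exact hb ⟨a, haA, h⟩
  have hface := hA _ hsub hnbly i
  rw [hsup] at hface
  have hai : a i = (b ⊔ β) i := le_antisymm (hle i) hi
  rcases le_total (b i) (β i) with h | h
  · exact haβ (hface ⟨haA, hle, hai⟩ ⟨hβ, le_sup_right, (sup_eq_right.2 h).symm⟩)
  · exact hab (hface ⟨haA, hle, hai⟩ ⟨hbA, le_sup_left, (sup_eq_left.2 h).symm⟩)
end

section
/- Let D be a down-set in ℝⁿ and let ∂D denote its topological frontier. Then for b ∈ ℝⁿ: b ∈ ∂D if and only if every x ∈ ℝⁿ with b << x satisfies x ∉ D, and every x ∈ ℝⁿ with x << b satisfies x ∈ D. -/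
/-- `D` is a down-set in `ℝⁿ`. -/
def IsDownSet {n : ℕ} (D : Set (Fin n → ℝ)) : Prop :=
  ∀ x ∈ D, ∀ y, y ≤ x → y ∈ D

open Filter Topology in
theorem tendsto_add_const_mul_nhdsGT_zero {n : ℕ} (b : Fin n → ℝ) (c : ℝ) :
    Tendsto (fun (t : ℝ) (i : Fin n) => b i + c * t) (𝓝[>] 0) (𝓝 b) := by
  have h : Continuous fun (t : ℝ) (i : Fin n) => b i + c * t := by fun_prop
  simpa using (h.tendsto 0).mono_left nhdsWithin_le_nhds

theorem stmt11 {n : ℕ} (D : Set (Fin n → ℝ)) (hD : IsDownSet D) (b : Fin n → ℝ) :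
    b ∈ frontier D ↔
      (∀ x, (∀ i, b i < x i) → x ∉ D) ∧ (∀ x, (∀ i, x i < b i) → x ∈ D) := by
  constructor
  · rintro ⟨hcl, hint⟩
    refine ⟨fun x hx hxD => hint ?_, fun x hx => ?_⟩
    · have hopen : IsOpen {y : Fin n → ℝ | ∀ i, y i < x i} := by
        simp only [Set.ofPred_forall]
        exact isOpen_iInter_of_finite fun i => isOpen_lt (continuous_apply i) continuous_const
      exact mem_interior.2 ⟨_, fun y hy => hD x hxD y fun i => (hy i).le, hopen, hx⟩
    · have hopen : IsOpen {y : Fin n → ℝ | ∀ i, x i < y i} := by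
        simp only [Set.ofPred_forall]
        exact isOpen_iInter_of_finite fun i => isOpen_lt continuous_const (continuous_apply i)
      obtain ⟨y, hy, hyD⟩ := mem_closure_iff.1 hcl _ hopen hx
      exact hD y hyD x fun i => (hy i).le
  · rintro ⟨hup, hdown⟩
    refine ⟨mem_closure_of_tendsto (tendsto_add_const_mul_nhdsGT_zero b (-1)) ?_, fun hint => ?_⟩
    · filter_upwards [self_mem_nhdsWithin] with t ht
      have ht' : 0 < t := ht
      exact hdown _ fun i => by linarith
    · have hmem := (tendsto_add_const_mul_nhdsGT_zero b 1).eventually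
        (mem_interior_iff_mem_nhds.1 hint)
      obtain ⟨t, htD, ht⟩ := (hmem.and self_mem_nhdsWithin).exists
      have ht' : 0 < t := ht
      exact hup _ (fun i => by linarith) htD
end

section
/- Let A ⊆ ℝⁿ be a generic antichain. If B ⊆ A is a finite nonempty A-neighborly set, then ⋁B lies in the topological frontier of dmA. In particular, A ⊆ ∂dmA. -/
/-- `A` is an antichain for the coordinatewise partial order. -/
def IsAntichainLe {n : ℕ} (A : Set (Fin n → ℝ)) : Prop :=
  ∀ x ∈ A, ∀ y ∈ A, x ≤ y → x = y

/-- `M` is a maximal `A`-neighborly subset of `A`. -/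
def IsMaxNbly {n : ℕ} (A M : Set (Fin n → ℝ)) : Prop :=
  M ⊆ A ∧ IsNbly A M ∧ ∀ M' ⊆ A, IsNbly A M' → M ⊆ M' → M' = M

/-- `mA`: the set of suprema of maximal `A`-neighborly subsets of `A`. -/
def mSet {n : ℕ} (A : Set (Fin n → ℝ)) : Set (Fin n → ℝ) :=
  {x | ∃ M, IsMaxNbly A M ∧ x = sSup M}

/-- `dmA = mA - 𝕆ⁿ`: the down-set generated by `mA`. -/
def dmSet {n : ℕ} (A : Set (Fin n → ℝ)) : Set (Fin n → ℝ) :=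
  {x | ∃ m ∈ mSet A, x ≤ m}

theorem IsNbly.le_sSup {n : ℕ} {A B : Set (Fin n → ℝ)} (hB : IsNbly A B) {b : Fin n → ℝ}
    (hb : b ∈ B) : b ≤ sSup B :=
  le_csSup hB.2.1 hb

theorem IsNbly.exists_eq_sSup {n : ℕ} {A B : Set (Fin n → ℝ)} (hB : IsNbly A B) (hBA : B ⊆ A)
    {b : Fin n → ℝ} (hb : b ∈ B) : ∃ i, b i = sSup B i := by
  by_contra! h
  exact hB.2.2 b (hBA hb) fun i => lt_of_le_of_ne (hB.le_sSup hb i) (h i)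

/-- A neighborly subset of a generic set in dimension `n` has at most `n` elements. -/
theorem IsGeneric.encard_le {n : ℕ} {A B : Set (Fin n → ℝ)} (hA : IsGeneric A) (hBA : B ⊆ A)
    (hB : IsNbly A B) : B.encard ≤ n := by
  obtain ⟨b₀, hb₀⟩ := hB.1
  have : Nonempty (Fin n) := (hB.exists_eq_sSup hBA hb₀).nonempty
  choose! f hf using fun b (hb : b ∈ B) => hB.exists_eq_sSup hBA hb
  have hinj : Set.InjOn f B := fun a ha b hb hab =>
    hA B hBA hB (f a) ⟨hBA ha, hB.le_sSup ha, hf a ha⟩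
      ⟨hBA hb, hB.le_sSup hb, by rw [hab]; exact hf b hb⟩
  calc B.encard = (f '' B).encard := hinj.encard_image.symm
    _ ≤ (Set.univ : Set (Fin n)).encard := Set.encard_le_encard (Set.subset_univ _)
    _ = n := by simp

theorem IsGeneric.exists_isMaxNbly_superset {n : ℕ} {A B : Set (Fin n → ℝ)} (hA : IsGeneric A)
    (hBA : B ⊆ A) (hB : IsNbly A B) : ∃ M, IsMaxNbly A M ∧ B ⊆ M := by
  have hfinite : ∀ M ⊆ A, IsNbly A M → M.Finite ∧ M.ncard ≤ n := fun M hMA hM => by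
    have hfin : M.Finite := Set.finite_of_encard_le_coe (hA.encard_le hMA hM)
    refine ⟨hfin, ?_⟩
    have h := hA.encard_le hMA hM
    rw [← hfin.cast_ncard_eq] at h
    exact_mod_cast h
  let S : Set ℕ := {k | ∃ M ⊆ A, IsNbly A M ∧ B ⊆ M ∧ M.ncard = k}
  have hS : BddAbove S := ⟨n, by rintro _ ⟨M, hMA, hM, -, rfl⟩; exact (hfinite M hMA hM).2⟩
  obtain ⟨M, hMA, hM, hBM, hk⟩ : sSup S ∈ S :=
    Nat.sSup_mem ⟨_, B, hBA, hB, subset_rfl, rfl⟩ hS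
  refine ⟨M, ⟨hMA, hM, fun M' hM'A hM' hMM' => ?_⟩, hBM⟩
  have hle : M'.ncard ≤ M.ncard := hk ▸ le_csSup hS ⟨M', hM'A, hM', hBM.trans hMM', rfl⟩
  exact (Set.eq_of_subset_of_ncard_le hMM' hle (hfinite M' hM'A hM').1).symm

theorem IsGeneric.sSup_mem_frontier_dmSet {n : ℕ} {A B : Set (Fin n → ℝ)} (hA : IsGeneric A)
    (hBA : B ⊆ A) (hB : IsNbly A B) : sSup B ∈ frontier (dmSet A) := by
  refine ⟨subset_closure ?_, fun hint => ?_⟩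
  · obtain ⟨M, hM, hBM⟩ := hA.exists_isMaxNbly_superset hBA hB
    exact ⟨sSup M, ⟨M, hM, rfl⟩, csSup_le_csSup hM.2.1.2.1 hB.1 hBM⟩
  · have hcont : Filter.Tendsto (fun t : ℝ => sSup B + fun _ => t) (nhdsWithin 0 (Set.Ioi 0))
        (nhds (sSup B)) := by
      have h : Continuous (fun t : ℝ => sSup B + fun _ => t) := by fun_prop
      have h0 := h.tendsto 0
      have he : (sSup B + fun _ => (0 : ℝ)) = sSup B := add_zero _
      rw [he] at h0
      exact h0.mono_left nhdsWithin_le_nhds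
    obtain ⟨t, ⟨m, ⟨M, hM, rfl⟩, hle⟩, ht⟩ :=
      ((hcont.eventually (mem_interior_iff_mem_nhds.1 hint)).and self_mem_nhdsWithin).exists
    obtain ⟨b, hb⟩ := hB.1
    refine hM.2.1.2.2 b (hBA hb) fun i => ?_
    have h1 := hB.le_sSup hb i
    have h2 : sSup B i + t ≤ sSup M i := hle i
    have h3 : 0 < t := ht
    linarith

theorem IsAntichainLe.isNbly_singleton {n : ℕ} [NeZero n] {A : Set (Fin n → ℝ)}
    (hA : IsAntichainLe A) {a : Fin n → ℝ} (ha : a ∈ A) : IsNbly A {a} := by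
  refine ⟨Set.singleton_nonempty a, bddAbove_singleton, fun x hx hlt => ?_⟩
  rw [csSup_singleton] at hlt
  have hxa : x = a := hA x hx a ha fun i => (hlt i).le
  exact (hlt 0).ne (congrFun hxa 0)

theorem stmt12 {n : ℕ} (A : Set (Fin n → ℝ)) (hA : IsGeneric A)
    (hac : IsAntichainLe A) (B : Set (Fin n → ℝ)) (hBA : B ⊆ A)
    (hfin : B.Finite) (hne : B.Nonempty) (hB : IsNbly A B) :
    sSup B ∈ frontier (dmSet A) ∧ A ⊆ frontier (dmSet A) := by
  refine ⟨hA.sSup_mem_frontier_dmSet hBA hB, fun a ha => ?_⟩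
  obtain ⟨b, hb⟩ := hne
  obtain ⟨i, -⟩ := hB.exists_eq_sSup hBA hb
  have : NeZero n := ⟨fun h => (h ▸ i).elim0⟩
  simpa using hA.sSup_mem_frontier_dmSet (Set.singleton_subset_iff.2 ha) (hac.isNbly_singleton ha)
end

section
/- Let A ⊆ ℝⁿ be a generic antichain, m ≥ 1, and b : Fin m → ℝⁿ an injective map whose range is an A-neighborly subset of A. For j ∈ Fin m define c(j) := ⋁ { b(i) : i ≤ j } (coordinatewise supremum of the first j+1 points). Then the points c(0), …, c(m−1) are affinely independent in ℝⁿ. -/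
/-- The coordinatewise supremum of a nonempty finite set is attained in each coordinate. -/
theorem exists_mem_apply_eq_sSup_apply {ι : Type*} {S : Set (ι → ℝ)} (hS : S.Finite)
    (hne : S.Nonempty) (x : ι) : ∃ f ∈ S, f x = sSup S x := by
  have : Finite S := hS
  have : Nonempty S := hne.to_subtype
  obtain ⟨f, hf⟩ := exists_eq_ciSup_of_finite (f := fun f : S => f.1 x)
  exact ⟨f.1, f.2, by rw [hf, sSup_apply]⟩

theorem apply_le_sSup_apply {ι : Type*} {S : Set (ι → ℝ)} (hS : S.Finite)
    {f : ι → ℝ} (hf : f ∈ S) (x : ι) : f x ≤ sSup S x := by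
  have : Finite S := hS
  rw [sSup_apply]
  exact le_ciSup (f := fun f : S => f.1 x) (Set.finite_range _).bddAbove ⟨f, hf⟩

/-- In a finite family spanning a neighborly subset of a generic set, every member is the
strict maximum of the family in some coordinate. -/
theorem IsGeneric.exists_coord_strict_max {n m : ℕ} {A : Set (Fin n → ℝ)} (hA : IsGeneric A)
    {b : Fin m → (Fin n → ℝ)} (hinj : Function.Injective b) (hrange : Set.range b ⊆ A)
    (hnb : IsNbly A (Set.range b)) (j : Fin m) : ∃ x, ∀ k, k ≠ j → b k x < b j x := by
  have hle : ∀ k x, b k x ≤ sSup (Set.range b) x := fun k x =>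
    apply_le_sSup_apply (Set.finite_range b) ⟨k, rfl⟩ x
  have h := hnb.2.2 (b j) (hrange ⟨j, rfl⟩)
  push Not at h
  obtain ⟨x, hx⟩ := h
  have hjx := le_antisymm (hle j x) hx
  refine ⟨x, fun k hkj => lt_of_le_of_ne (hjx ▸ hle k x) fun hk => hkj (hinj ?_)⟩
  exact hA _ hrange hnb x ⟨hrange ⟨k, rfl⟩, hle k, hk.trans hjx⟩ ⟨hrange ⟨j, rfl⟩, hle j, hjx⟩

/-- A finite sequence of points is affinely independent if every index `j` has a coordinate that
is constant from `j` onwards and different from that constant before `j`. -/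
theorem affineIndependent_of_eventually_const_coord {κ : Type*} {m : ℕ} {c : Fin m → (κ → ℝ)}
    (h : ∀ j, ∃ x, (∀ k, j ≤ k → c k x = c j x) ∧ ∀ k < j, c k x ≠ c j x) :
    AffineIndependent ℝ c := by
  rw [affineIndependent_iff]
  intro s w hw hwc e
  induction e using WellFoundedLT.induction with
  | ind e ih =>
    intro he
    by_cases hlast : (e : ℕ) + 1 < m
    · obtain ⟨x, hconst, hne⟩ := h ⟨e + 1, hlast⟩
      set M := c ⟨e + 1, hlast⟩ x
      have hsum : ∑ k ∈ s, w k * (c k x - M) = 0 := by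
        have hx := congrFun hwc x
        simp only [Finset.sum_apply, Pi.smul_apply, smul_eq_mul, Pi.zero_apply] at hx
        simp only [mul_sub, Finset.sum_sub_distrib, ← Finset.sum_mul, hx, hw, zero_mul, sub_zero]
      rw [Finset.sum_eq_single_of_mem e he] at hsum
      · exact (mul_eq_zero.1 hsum).resolve_right
          (sub_ne_zero.2 (hne e (Fin.lt_def.2 (Nat.lt_succ_self _))))
      · intro k hk hke
        rcases lt_or_gt_of_ne hke with hlt | hgt
        · rw [ih k hlt hk, zero_mul]
        · rw [hconst k (Fin.le_def.2 (Nat.succ_le_of_lt hgt)), sub_self, mul_zero]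
    · rwa [Finset.sum_eq_single_of_mem e he fun k hk hke => ih k (by omega) hk] at hw

theorem stmt13 {n : ℕ} (A : Set (Fin n → ℝ)) (hA : IsGeneric A)
    (hac : IsAntichainLe A) (m : ℕ) (hm : 1 ≤ m) (b : Fin m → (Fin n → ℝ))
    (hinj : Function.Injective b) (hrange : Set.range b ⊆ A)
    (hnb : IsNbly A (Set.range b)) :
    AffineIndependent ℝ (fun j : Fin m => sSup (b '' {i | i ≤ j})) := by
  refine affineIndependent_of_eventually_const_coord fun j => ?_
  obtain ⟨x, hx⟩ := hA.exists_coord_strict_max hinj hrange hnb j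
  have hfin : ∀ k, (b '' {i | i ≤ k}).Finite := fun k => (Set.toFinite _).image b
  have hattained : ∀ k, ∃ i ≤ k, b i x = sSup (b '' {i | i ≤ k}) x := fun k => by
    obtain ⟨_, ⟨i, hi, rfl⟩, h⟩ :=
      exists_mem_apply_eq_sSup_apply (hfin k) ⟨b k, k, le_refl k, rfl⟩ x
    exact ⟨i, hi, h⟩
  have hmax : ∀ k, j ≤ k → sSup (b '' {i | i ≤ k}) x = b j x := fun k hjk => by
    refine le_antisymm ?_ (apply_le_sSup_apply (hfin k) ⟨j, hjk, rfl⟩ x)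
    obtain ⟨i, -, h⟩ := hattained k
    rw [← h]
    rcases eq_or_ne i j with rfl | hij
    · exact le_rfl
    · exact (hx i hij).le
  refine ⟨x, fun k hjk => (hmax k hjk).trans (hmax j le_rfl).symm, fun k hkj => ?_⟩
  obtain ⟨i, hik, h⟩ := hattained k
  rw [hmax j le_rfl, ← h]
  exact (hx i (hik.trans_lt hkj).ne).ne
end

section
/- Let A ⊆ ℝⁿ be a generic antichain, m ≥ 1, and let b, b' : Fin m → ℝⁿ be injective maps whose ranges are A-neighborly subsets of A. Define c(j) := ⋁ { b(i) : i ≤ j } and c'(j) := ⋁ { b'(i) : i ≤ j } for j ∈ Fin m. If the convex hull of { c(0), …, c(m−1) } equals the convex hull of { c'(0), …, c'(m−1) }, then b = b' (the underlying sets and the orderings coincide). -/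
theorem IsNbly.subset {n : ℕ} {A B C : Set (Fin n → ℝ)} (hB : IsNbly A B)
    (hC : C.Nonempty) (hCB : C ⊆ B) : IsNbly A C :=
  ⟨hC, hB.2.1.mono hCB, fun a ha h =>
    hB.2.2 a ha fun i => (h i).trans_le (csSup_le_csSup hB.2.1 hC hCB i)⟩

theorem exists_mem_apply_eq_sSup_apply_s15 {n : ℕ} {B : Set (Fin n → ℝ)} (hfin : B.Finite)
    (hne : B.Nonempty) (i : Fin n) : ∃ x ∈ B, x i = sSup B i := by
  rw [sSup_apply_eq_sSup_image]
  exact (hne.image _).csSup_mem (hfin.image _)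

/-- In a generic set, a finite neighborly subset is recovered from its supremum. -/
theorem IsGeneric.mem_of_le_sSup {n : ℕ} {A B : Set (Fin n → ℝ)} (hA : IsGeneric A)
    (hBA : B ⊆ A) (hB : IsNbly A B) (hfin : B.Finite) {a : Fin n → ℝ} (ha : a ∈ A)
    (hle : a ≤ sSup B) : a ∈ B := by
  obtain ⟨i, hi⟩ := not_forall.1 (hB.2.2 a ha)
  obtain ⟨x, hx, hxi⟩ := exists_mem_apply_eq_sSup_apply_s15 hfin hB.1 i
  have hax : a = x := hA B hBA hB i ⟨ha, hle, (hle i).antisymm (not_lt.1 hi)⟩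
    ⟨hBA hx, le_csSup hB.2.1 hx, hxi⟩
  exact hax ▸ hx

/-- A coordinate in which the chain `c` increases strictly up to `c j` and is constant from
there on shows that `c j` is a vertex of the convex hull of the chain. -/
theorem Monotone.mem_extremePoints_convexHull_range {ι κ : Type*} [LinearOrder κ]
    {c : κ → ι → ℝ} (hc : Monotone c) {j : κ} {i : ι} (hlt : ∀ l < j, c l i < c j i)
    (heq : ∀ l, j ≤ l → c l i = c j i) :
    c j ∈ (convexHull ℝ (Set.range c)).extremePoints ℝ := by
  have hsub : convexHull ℝ (Set.range c) ⊆ {x | x i < c j i ∨ (x i = c j i ∧ c j ≤ x)} := by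
    refine convexHull_min ?_ ?_
    · rintro _ ⟨l, rfl⟩
      rcases lt_or_ge l j with h | h
      · exact Or.inl (hlt l h)
      · exact Or.inr ⟨heq l h, hc h⟩
    · refine convex_iff_forall_pos.2 fun x hx y hy s t hs ht hst => ?_
      simp only [Set.mem_ofPred_eq, Pi.add_apply, Pi.smul_apply, smul_eq_mul] at hx hy ⊢
      have hcj : c j i = s * c j i + t * c j i := by rw [← add_mul, hst, one_mul]
      rcases hx with hx | ⟨hx, hx'⟩
      · have hy' : y i ≤ c j i := hy.elim le_of_lt fun h => h.1.le
        exact Or.inl (by nlinarith [mul_lt_mul_of_pos_left hx hs,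
          mul_le_mul_of_nonneg_left hy' ht.le])
      · rcases hy with hy | ⟨hy, hy'⟩
        · exact Or.inl (by rw [hx]; nlinarith [mul_lt_mul_of_pos_left hy ht])
        · exact Or.inr ⟨by rw [hx, hy, ← hcj], convex_Ici (𝕜 := ℝ) (c j) hx' hy' hs.le ht.le hst⟩
  refine mem_extremePoints_iff_left.2 ⟨subset_convexHull ℝ _ ⟨j, rfl⟩, ?_⟩
  rintro x hx y hy ⟨s, t, hs, ht, hst, h⟩
  have hk : ∀ k, s * x k + t * y k = s * c j k + t * c j k := fun k => by
    rw [← add_mul, hst, one_mul, ← h]; rfl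
  have key : c j ≤ x ∧ c j ≤ y := by
    rcases hsub hx with hx | ⟨hx, hx'⟩ <;> rcases hsub hy with hy | ⟨hy, hy'⟩
    · nlinarith [hk i, mul_lt_mul_of_pos_left hx hs, mul_lt_mul_of_pos_left hy ht]
    · nlinarith [hk i, mul_lt_mul_of_pos_left hx hs]
    · nlinarith [hk i, mul_lt_mul_of_pos_left hy ht]
    · exact ⟨hx', hy'⟩
  funext k
  refine le_antisymm (le_of_mul_le_mul_left ?_ hs) (key.1 k)
  linarith [hk k, mul_le_mul_of_nonneg_left (key.2 k) ht.le]

section Chain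

variable {n m : ℕ} {A : Set (Fin n → ℝ)} {b : Fin m → Fin n → ℝ}

theorem monotone_sSup_image_le (hbdd : BddAbove (Set.range b)) :
    Monotone fun j => sSup (b '' {i | i ≤ j}) := fun j _ hjl =>
  csSup_le_csSup (hbdd.mono (Set.image_subset_range _ _)) ⟨b j, j, le_refl j, rfl⟩
    (Set.image_mono fun _ hi => le_trans hi hjl)

/-- Each step of the chain of partial suprema is seen by a coordinate that grows strictly up to
that step and is constant afterwards. -/
theorem IsGeneric.exists_coord (hA : IsGeneric A) (hinj : Function.Injective b)
    (hrange : Set.range b ⊆ A) (hnb : IsNbly A (Set.range b)) (j : Fin m) :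
    ∃ i, (∀ l < j, sSup (b '' {k | k ≤ l}) i < sSup (b '' {k | k ≤ j}) i) ∧
      ∀ l, j ≤ l → sSup (b '' {k | k ≤ l}) i = sSup (b '' {k | k ≤ j}) i := by
  obtain ⟨i, hi⟩ := not_forall.1 (hnb.2.2 (b j) (hrange ⟨j, rfl⟩))
  have hle : ∀ l, b l ≤ sSup (Set.range b) := fun l => le_csSup hnb.2.1 ⟨l, rfl⟩
  have hbj : b j i = sSup (Set.range b) i := (hle j i).antisymm (not_lt.1 hi)
  have htop : ∀ l, j ≤ l → sSup (b '' {k | k ≤ l}) i = b j i := by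
    intro l hl
    refine le_antisymm ?_
      (le_csSup (hnb.2.1.mono (Set.image_subset_range _ _)) ⟨j, hl, rfl⟩ i)
    obtain ⟨_, ⟨k, -, rfl⟩, hki⟩ :=
      exists_mem_apply_eq_sSup_apply_s15 (Set.toFinite (b '' {k | k ≤ l})) ⟨b j, j, hl, rfl⟩ i
    rw [← hki, hbj]
    exact hle k i
  refine ⟨i, fun l hl => ?_, fun l hl => by rw [htop l hl, htop j le_rfl]⟩
  obtain ⟨_, ⟨k, hkl, rfl⟩, hki⟩ :=
    exists_mem_apply_eq_sSup_apply_s15 (Set.toFinite (b '' {k | k ≤ l})) ⟨b l, l, le_refl l, rfl⟩ i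
  rw [htop j le_rfl, ← hki, hbj]
  refine (hle k i).lt_of_ne fun h => ?_
  have hkj : b k = b j := hA _ hrange hnb i ⟨hrange ⟨k, rfl⟩, hle k, h⟩
    ⟨hrange ⟨j, rfl⟩, hle j, hbj⟩
  exact (lt_of_le_of_lt hkl hl).ne (hinj hkj)

theorem IsGeneric.strictMono_sSup_image_le (hA : IsGeneric A) (hinj : Function.Injective b)
    (hrange : Set.range b ⊆ A) (hnb : IsNbly A (Set.range b)) :
    StrictMono fun j => sSup (b '' {i | i ≤ j}) :=
  (monotone_sSup_image_le hnb.2.1).strictMono_of_injective fun j l h => by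
    by_contra hjl
    rcases lt_or_gt_of_ne hjl with hlt | hlt
    · obtain ⟨i, hi, -⟩ := hA.exists_coord hinj hrange hnb l
      exact (hi j hlt).ne (congrFun h i)
    · obtain ⟨i, hi, -⟩ := hA.exists_coord hinj hrange hnb j
      exact (hi l hlt).ne (congrFun h i).symm

theorem IsGeneric.extremePoints_convexHull_range_sSup (hA : IsGeneric A)
    (hinj : Function.Injective b) (hrange : Set.range b ⊆ A) (hnb : IsNbly A (Set.range b)) :
    (convexHull ℝ (Set.range fun j => sSup (b '' {i | i ≤ j}))).extremePoints ℝ =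
      Set.range fun j => sSup (b '' {i | i ≤ j}) := by
  refine extremePoints_convexHull_subset.antisymm ?_
  rintro _ ⟨j, rfl⟩
  obtain ⟨i, hlt, heq⟩ := hA.exists_coord hinj hrange hnb j
  exact (monotone_sSup_image_le hnb.2.1).mem_extremePoints_convexHull_range hlt heq

theorem IsGeneric.image_le_eq (hA : IsGeneric A) (hrange : Set.range b ⊆ A)
    (hnb : IsNbly A (Set.range b)) (j : Fin m) :
    b '' {i | i ≤ j} = {a ∈ A | a ≤ sSup (b '' {i | i ≤ j})} := by
  have hsub := Set.image_subset_range b {i | i ≤ j}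
  refine Set.Subset.antisymm
    (fun a ha => ⟨hrange (hsub ha), le_csSup (hnb.2.1.mono hsub) ha⟩) fun a ha => ?_
  exact hA.mem_of_le_sSup (hsub.trans hrange) (hnb.subset ⟨b j, j, le_refl j, rfl⟩ hsub)
    (Set.toFinite _) ha.1 ha.2

end Chain

theorem eq_of_forall_image_le_eq {κ α : Type*} [PartialOrder κ] {b b' : κ → α}
    (hinj : Function.Injective b)
    (h : ∀ j, b '' {i | i ≤ j} = b' '' {i | i ≤ j}) : b = b' := by
  funext j
  obtain ⟨k, hkj, hk⟩ : b j ∈ b' '' {i | i ≤ j} := h j ▸ ⟨j, le_refl j, rfl⟩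
  obtain ⟨l, hlk, hl⟩ : b' k ∈ b '' {i | i ≤ k} := (h k).symm ▸ ⟨k, le_refl k, rfl⟩
  obtain rfl : l = j := hinj (hl.trans hk)
  obtain rfl : k = l := le_antisymm hkj hlk
  exact hk.symm

theorem stmt15 {n : ℕ} (A : Set (Fin n → ℝ)) (hA : IsGeneric A)
    (hac : IsAntichainLe A) (m : ℕ) (hm : 1 ≤ m) (b b' : Fin m → (Fin n → ℝ))
    (hinj : Function.Injective b) (hrange : Set.range b ⊆ A)
    (hnb : IsNbly A (Set.range b))
    (hinj' : Function.Injective b') (hrange' : Set.range b' ⊆ A)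
    (hnb' : IsNbly A (Set.range b'))
    (hhull : convexHull ℝ (Set.range fun j : Fin m => sSup (b '' {i | i ≤ j})) =
      convexHull ℝ (Set.range fun j : Fin m => sSup (b' '' {i | i ≤ j}))) :
    b = b' := by
  have hc : (fun j : Fin m => sSup (b '' {i | i ≤ j})) =
      fun j : Fin m => sSup (b' '' {i | i ≤ j}) := by
    refine ((hA.strictMono_sSup_image_le hinj hrange hnb).range_inj
      (hA.strictMono_sSup_image_le hinj' hrange' hnb')).1 ?_
    rw [← hA.extremePoints_convexHull_range_sSup hinj hrange hnb, hhull,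
      hA.extremePoints_convexHull_range_sSup hinj' hrange' hnb']
  refine eq_of_forall_image_le_eq hinj fun j => ?_
  rw [hA.image_le_eq hrange hnb, hA.image_le_eq hrange' hnb']
  simp only [congrFun hc j]
end

section
/- Let D ⊆ ℝⁿ be a proper down-set (D ≠ ∅ and D ≠ ℝⁿ), let p ∈ ℝⁿ with 0 << p, and let a ∈ ℝⁿ. Then the line { a + t • p : t ∈ ℝ } meets the topological frontier of D in exactly one point: there is a unique t ∈ ℝ with a + t • p ∈ ∂D. -/
theorem IsDownSet.isLowerSet {n : ℕ} {D : Set (Fin n → ℝ)} (hD : IsDownSet D) : IsLowerSet D :=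
  fun x y hyx hx => hD x hx y hyx

theorem exists_add_smul_le {n : ℕ} {p : Fin n → ℝ} (hp : ∀ i, 0 < p i) (a d : Fin n → ℝ) :
    ∃ t : ℝ, a + t • p ≤ d := by
  have h : ∀ᶠ t : ℝ in Filter.atBot, ∀ i, t ≤ (d i - a i) / p i :=
    Filter.eventually_all.2 fun i => Filter.eventually_le_atBot _
  obtain ⟨t, ht⟩ := h.exists
  refine ⟨t, fun i => ?_⟩
  have := (le_div_iff₀ (hp i)).1 (ht i)
  simp only [Pi.add_apply, Pi.smul_apply, smul_eq_mul]
  linarith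

theorem exists_le_add_smul {n : ℕ} {p : Fin n → ℝ} (hp : ∀ i, 0 < p i) (a d : Fin n → ℝ) :
    ∃ t : ℝ, d ≤ a + t • p := by
  obtain ⟨t, ht⟩ := exists_add_smul_le hp (-a) (-d)
  refine ⟨-t, fun i => ?_⟩
  have := ht i
  simp only [Pi.add_apply, Pi.smul_apply, Pi.neg_apply, smul_eq_mul] at this ⊢
  linarith

theorem IsLowerSet.not_lt_of_mem_frontier {n : ℕ} {D : Set (Fin n → ℝ)} (hD : IsLowerSet D)
    {p : Fin n → ℝ} (hp : ∀ i, 0 < p i) {a : Fin n → ℝ} {s t : ℝ}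
    (hs : a + s • p ∈ frontier D) (ht : a + t • p ∈ frontier D) : ¬ s < t := fun hst =>
  hs.2 <| hD.mem_interior_of_forall_lt ht.1 fun i => by
    simpa using mul_lt_mul_of_pos_right hst (hp i)

theorem stmt16 {n : ℕ} (D : Set (Fin n → ℝ)) (hD : IsDownSet D)
    (hne : D.Nonempty) (hproper : D ≠ Set.univ)
    (p : Fin n → ℝ) (hp : ∀ i, 0 < p i) (a : Fin n → ℝ) :
    ∃! t : ℝ, a + t • p ∈ frontier D := by
  obtain ⟨d, hd⟩ := hne
  obtain ⟨e, he⟩ := (Set.ne_univ_iff_exists_notMem D).1 hproper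
  obtain ⟨s, hs⟩ := exists_add_smul_le hp a d
  obtain ⟨u, hu⟩ := exists_le_add_smul hp a e
  have hcont : Continuous fun t : ℝ => a + t • p := by fun_prop
  have hfront : (frontier ((fun t : ℝ => a + t • p) ⁻¹' D)).Nonempty :=
    nonempty_frontier_iff.2 ⟨⟨s, hD d hd _ hs⟩,
      (Set.ne_univ_iff_exists_notMem _).2 ⟨u, fun h => he (hD _ h e hu)⟩⟩
  obtain ⟨t, ht⟩ := hfront
  have htD : a + t • p ∈ frontier D := hcont.frontier_preimage_subset D ht
  refine ⟨t, htD, fun r hr => ?_⟩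
  exact le_antisymm (not_lt.1 (hD.isLowerSet.not_lt_of_mem_frontier hp htD hr))
    (not_lt.1 (hD.isLowerSet.not_lt_of_mem_frontier hp hr htD))
end

section
/- Let A ⊆ ℝⁿ be a finite nonempty antichain. Define L(A) := { ⋁C : C a nonempty subset of A } and P(A) := { p ∈ L(A) : there is no a ∈ A with a << p }. Then a nonempty subset C ⊆ A has an upper bound in P(A) if and only if C is A-neighborly. (Thus A is a crosscut in P(A) and the complex of P(A)-bounded subsets of A is exactly Nb(A).) -/
/-- `L(A)`: the set of suprema of nonempty subsets of `A`. -/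
def scarfL {n : ℕ} (A : Set (Fin n → ℝ)) : Set (Fin n → ℝ) :=
  {x | ∃ C ⊆ A, C.Nonempty ∧ x = sSup C}

/-- `P(A)`: the elements of `L(A)` with no element of `A` strictly below them. -/
def scarfP {n : ℕ} (A : Set (Fin n → ℝ)) : Set (Fin n → ℝ) :=
  {p ∈ scarfL A | ¬ ∃ a ∈ A, ∀ i, a i < p i}

theorem sSup_pi_le {n : ℕ} {C : Set (Fin n → ℝ)} (hC : C.Nonempty) {p : Fin n → ℝ}
    (h : ∀ c ∈ C, c ≤ p) : sSup C ≤ p := by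
  intro i
  have := hC.to_subtype
  rw [sSup_apply]
  exact ciSup_le fun c => h c c.2 i

theorem le_sSup_pi_s17 {n : ℕ} {C : Set (Fin n → ℝ)} (hC : BddAbove C) {c : Fin n → ℝ}
    (hc : c ∈ C) : c ≤ sSup C := by
  intro i
  obtain ⟨b, hb⟩ := hC
  rw [sSup_apply]
  exact le_ciSup (f := fun f : C => f.1 i) ⟨b i, by rintro _ ⟨f, rfl⟩; exact hb f.2 i⟩ ⟨c, hc⟩

theorem stmt17 {n : ℕ} (A : Set (Fin n → ℝ)) (hfin : A.Finite) (hne : A.Nonempty)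
    (hac : IsAntichainLe A) (C : Set (Fin n → ℝ)) (hCA : C ⊆ A) (hCne : C.Nonempty) :
    (∃ p ∈ scarfP A, ∀ c ∈ C, c ≤ p) ↔ IsNbly A C := by
  constructor
  · rintro ⟨p, ⟨-, hp⟩, hCp⟩
    exact ⟨hCne, ⟨p, hCp⟩, fun a ha h =>
      hp ⟨a, ha, fun i => (h i).trans_le (sSup_pi_le hCne hCp i)⟩⟩
  · rintro ⟨-, hbdd, hC⟩
    exact ⟨sSup C, ⟨⟨C, hCA, hCne, rfl⟩, fun ⟨a, ha, h⟩ => hC a ha h⟩,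
      fun c hc => le_sSup_pi_s17 hbdd hc⟩
end
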